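/- Fix ε>0, integers n,m≥1, points X₁,…,X_{n+m}∈ℝ^d, and constants γ,κ>0. Suppose W:ℝ→[0,∞) is continuously differentiable with W'(t)≤0 for all t≤−1 and W'(t)≥0 for all t≥1. Let (u₁,…,u_n) be a continuously differentiable solution on [0,T] of the system du_i/dt = (γ/(ε²(n+m))) Σ_{j=1}^{n+m} η_ε(|X_i−X_j|)(u_j−u_i) − κ W'(u_i) for i=1,…,n, where u_j(t)≡−1 for j∈V₁' and u_j(t)≡1 for j∈V₂'. If u_i(0)∈[−1,1] for all i=1,…,n, then u_i(t)∈[−1,1] for all i=1,…,n and all t∈[0,T]. -/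

import Mathlib

open MeasureTheory Set

/-- The rescaled interaction kernel `η_ε(s) = ε^{-d} η(s/ε)`. -/
noncomputable def etaEps (d : ℕ) (ε : ℝ) (η : ℝ → ℝ) (s : ℝ) : ℝ :=
  η (s / ε) / ε ^ d

/-- Right-hand side of the microscopic label-propagation ODE for the (unlabeled) index `i`. -/
noncomputable def microRHS (d n m : ℕ) (X : Fin (n + m) → EuclideanSpace ℝ (Fin d))
    (γ κ ε : ℝ) (η W : ℝ → ℝ) (u : Fin (n + m) → ℝ → ℝ) (i : Fin (n + m)) (t : ℝ) : ℝ :=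
  (γ / (ε ^ 2 * (n + m))) *
      (∑ j : Fin (n + m), etaEps d ε η ‖X i - X j‖ * (u j t - u i t))
    - κ * deriv W (u i t)

/-- Maximum principle for finitely many continuous functions on `[0, T]`: if, at every time, any
function realising the maximum above the level `c` has nonpositive derivative, then functions
starting below `c` stay below `c`. -/
theorem le_of_deriv_nonpos_at_max {ι : Type*} [Finite ι] {T c : ℝ} {u : ι → ℝ → ℝ}
    (hu : ∀ i, ContinuousOn (u i) (Set.Icc 0 T)) (h0 : ∀ i, u i 0 ≤ c)
    (hmax : ∀ i, ∀ t ∈ Set.Icc (0 : ℝ) T, c < u i t → (∀ j, u j t ≤ u i t) →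
      ∃ v ≤ 0, HasDerivAt (u i) v t)
    (i : ι) {t : ℝ} (ht : t ∈ Set.Icc (0 : ℝ) T) : u i t ≤ c := by
  have barrier : ∀ δ > 0, u i t - δ * t ≤ c := by
    intro δ hδ
    have hex : ∀ j, ∃ s ∈ Set.Icc (0 : ℝ) T,
        IsMaxOn (fun r => u j r - δ * r) (Set.Icc 0 T) s := fun j =>
      isCompact_Icc.exists_isMaxOn ⟨t, ht⟩ ((hu j).sub (by fun_prop))
    choose s hs hsmax using hex
    have : Nonempty ι := ⟨i⟩
    obtain ⟨k, hk⟩ := Finite.exists_max fun j => u j (s j) - δ * s j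
    have hglob : ∀ j, ∀ r ∈ Set.Icc (0 : ℝ) T, u j r - δ * r ≤ u k (s k) - δ * s k :=
      fun j r hr => (hsmax j hr).trans (hk j)
    by_contra! hlt
    have hck : c < u k (s k) - δ * s k := hlt.trans_le (hglob i t ht)
    have hδs : 0 ≤ δ * s k := mul_nonneg hδ.le (hs k).1
    have hpos : 0 < s k := by
      refine (hs k).1.lt_of_ne fun h => ?_
      rw [← h] at hck
      linarith [h0 k]
    obtain ⟨v, hv, hd⟩ := hmax k (s k) (hs k) (by linarith)
      fun j => by linarith [hglob j (s k) (hs k)]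
    have hd' : HasDerivAt (fun r => u k r - δ * r) (v - δ * 1) (s k) :=
      hd.sub ((hasDerivAt_id (s k)).const_mul δ)
    have hslope := hd'.tendsto_slope.mono_left (nhdsLT_le_nhdsNE (s k))
    have hneg := hslope.eventually_lt_const (by linarith : v - δ * 1 < 0)
    obtain ⟨r, hr, hr'⟩ := (hneg.and (Ioo_mem_nhdsLT hpos)).exists
    have hle := hglob k r ⟨hr'.1.le, hr'.2.le.trans (hs k).2⟩
    rw [slope_def_field] at hr
    exact hr.not_ge (div_nonneg_of_nonpos (by linarith) (by linarith [hr'.2]))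
  refine le_of_forall_pos_le_add fun e he => ?_
  have hT : 0 < 1 + t := by linarith [ht.1]
  have hb := barrier (e / (1 + t)) (by positivity)
  have : e / (1 + t) * t ≤ e := by
    rw [div_mul_eq_mul_div, div_le_iff₀ hT]
    nlinarith
  linarith

theorem etaEps_nonneg {d : ℕ} {ε : ℝ} {η : ℝ → ℝ} (hε : 0 < ε) (hη : ∀ s, 0 ≤ η s) (s : ℝ) :
    0 ≤ etaEps d ε η s :=
  div_nonneg (hη _) (by positivity)

/-- Discrete maximum principle: if `W'(t) ≤ 0` for `t ≤ -1` and `W'(t) ≥ 0`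
for `t ≥ 1`, then labels starting in `[-1,1]` stay in `[-1,1]` on `[0,T]`. -/
theorem micro_maximum_principle
    (d n m : ℕ) (hn : 1 ≤ n) (hm : 1 ≤ m)
    (X : Fin (n + m) → EuclideanSpace ℝ (Fin d))
    (γ κ ε T : ℝ) (hγ : 0 < γ) (hκ : 0 < κ) (hε : 0 < ε) (hT : 0 < T)
    (η : ℝ → ℝ) (hη_nonneg : ∀ s, 0 ≤ η s) (hη0 : 0 < η 0)
    (hη_cont : ContinuousAt η 0) (hη_mono : AntitoneOn η (Set.Ici 0))
    (hη_int : IntegrableOn (fun s => η s * s ^ (d + 1)) (Set.Ioi 0))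
    (W : ℝ → ℝ) (hW1 : ContDiff ℝ 1 W) (hW_nonneg : ∀ t, 0 ≤ W t)
    (hW'le : ∀ t : ℝ, t ≤ -1 → deriv W t ≤ 0)
    (hW'ge : ∀ t : ℝ, 1 ≤ t → 0 ≤ deriv W t)
    (V₁ V₂ : Set (Fin (n + m)))
    (hV_disj : Disjoint V₁ V₂)
    (hV_union : V₁ ∪ V₂ = {i : Fin (n + m) | n ≤ (i : ℕ)})
    (u : Fin (n + m) → ℝ → ℝ)
    (hreg : ∀ i, ContDiffOn ℝ 1 (u i) (Set.Icc 0 T))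
    (hode : ∀ i : Fin (n + m), (i : ℕ) < n → ∀ t ∈ Set.Icc (0 : ℝ) T,
      HasDerivAt (u i) (microRHS d n m X γ κ ε η W u i t) t)
    (hV₁ : ∀ j ∈ V₁, ∀ t : ℝ, u j t = -1)
    (hV₂ : ∀ j ∈ V₂, ∀ t : ℝ, u j t = 1)
    (hinit : ∀ i : Fin (n + m), (i : ℕ) < n → u i 0 ∈ Set.Icc (-1 : ℝ) 1) :
    ∀ i : Fin (n + m), (i : ℕ) < n → ∀ t ∈ Set.Icc (0 : ℝ) T,
      u i t ∈ Set.Icc (-1 : ℝ) 1 := by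
  have hcont : ∀ i, ContinuousOn (u i) (Set.Icc 0 T) := fun i => (hreg i).continuousOn
  have hcoef : 0 ≤ γ / (ε ^ 2 * (n + m)) := by positivity
  have hlabel : ∀ i : Fin (n + m), ¬ (i : ℕ) < n →
      (∀ t, u i t = -1) ∨ (∀ t, u i t = 1) := by
    intro i hi
    have : i ∈ V₁ ∪ V₂ := by
      rw [hV_union]
      exact not_lt.mp hi
    exact this.imp (hV₁ i) (hV₂ i)
  have hstart : ∀ i, u i 0 ∈ Set.Icc (-1 : ℝ) 1 := by
    intro i
    by_cases hi : (i : ℕ) < n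
    · exact hinit i hi
    · rcases hlabel i hi with h | h <;> rw [h] <;> norm_num
  intro i _ t ht
  constructor
  · have hneg : -u i t ≤ 1 := by
      refine le_of_deriv_nonpos_at_max (u := fun i t => -u i t) (fun i => (hcont i).neg)
        (fun i => by linarith [(hstart i).1]) (fun k s hs hlt hle => ?_) i ht
      have hk : (k : ℕ) < n := by
        by_contra hk
        rcases hlabel k hk with h | h <;> rw [h] at hlt <;> norm_num at hlt
      refine ⟨_, ?_, (hode k hk s hs).neg⟩
      have hsum : 0 ≤ ∑ j, etaEps d ε η ‖X k - X j‖ * (u j s - u k s) :=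
        Finset.sum_nonneg fun j _ =>
          mul_nonneg (etaEps_nonneg hε hη_nonneg _) (by linarith [hle j])
      have hW := mul_nonpos_of_nonneg_of_nonpos hκ.le (hW'le (u k s) (by linarith))
      have hdiff := mul_nonneg hcoef hsum
      unfold microRHS
      linarith
    linarith
  · refine le_of_deriv_nonpos_at_max hcont (fun i => (hstart i).2) (fun k s hs hlt hle => ?_) i ht
    have hk : (k : ℕ) < n := by
      by_contra hk
      rcases hlabel k hk with h | h <;> rw [h] at hlt <;> norm_num at hlt
    refine ⟨_, ?_, hode k hk s hs⟩
    have hsum : ∑ j, etaEps d ε η ‖X k - X j‖ * (u j s - u k s) ≤ 0 :=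
      Finset.sum_nonpos fun j _ =>
        mul_nonpos_of_nonneg_of_nonpos (etaEps_nonneg hε hη_nonneg _) (by linarith [hle j])
    have hW := mul_nonneg hκ.le (hW'ge (u k s) hlt.le)
    have hdiff := mul_nonpos_of_nonneg_of_nonpos hcoef hsum
    unfold microRHS
    linarith
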